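/- Let G be a strongly connected directed graph on {1,…,N} with self-loops, and let ε, C₁, C₂ > 0. For each n ≥ 0 let P^{(n)} = D^{(n)} A^{(n)}, where A^{(n)} is row-stochastic and ε-supported on G, and D^{(n)} is diagonal with C₁ ≤ D^{(n)}_{ii} ≤ C₂ for all i. Then the sequence of partial products P^{(t)} ⋯ P^{(1)} P^{(0)} is ergodic: there exists a sequence {S^{(t)}}_{t≥0} of entrywise positive rank-one N×N matrices such that lim_{t→∞} (P^{(t)} ⋯ P^{(0)})_{ij} / S^{(t)}_{ij} = 1 for all i, j ∈ {1,…,N}. -/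

import Mathlib

/-- Directed paths of length exactly `m` in the graph with edge relation `E`
(`E a b` means there is a directed edge from `a` to `b`). -/
def relPow {N : ℕ} (E : Fin N → Fin N → Prop) : ℕ → Fin N → Fin N → Prop
  | 0 => fun u v => u = v
  | m + 1 => fun u v => ∃ c, E u c ∧ relPow E m c v

/-- The backward product `P^{(t+T-1)} ⋯ P^{(t+1)} P^{(t)}` of `T` consecutive matrices. -/
def prodFrom {N : ℕ} (P : ℕ → Matrix (Fin N) (Fin N) ℝ) : ℕ → ℕ → Matrix (Fin N) (Fin N) ℝ
  | _, 0 => 1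
  | t, T + 1 => prodFrom P (t + 1) T * P t

open Filter Topology Matrix

/-- A path can be lengthened arbitrarily by inserting self-loops. -/
lemma relPow_mono {N : ℕ} {E : Fin N → Fin N → Prop} (hloop : ∀ i, E i i) {m n : ℕ} (hmn : m ≤ n)
    {u v : Fin N} (h : relPow E m u v) : relPow E n u v := by
  induction n, hmn using Nat.le_induction with
  | base => exact h
  | succ n _ ih => exact ⟨u, hloop u, ih⟩

/-- In a strongly connected graph with self-loops, all sufficiently long path lengths are
realised between every pair of vertices. -/
lemma exists_forall_relPow {N : ℕ} {E : Fin N → Fin N → Prop} (hloop : ∀ i, E i i)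
    (hconn : ∀ u v, ∃ m, relPow E m u v) : ∃ L, ∀ n, L ≤ n → ∀ u v, relPow E n u v := by
  choose f hf using hconn
  refine ⟨∑ u, ∑ v, f u v, fun n hn u v ↦ relPow_mono hloop (le_trans ?_ hn) (hf u v)⟩
  exact (Finset.single_le_sum (f := fun v ↦ f u v) (fun _ _ ↦ Nat.zero_le _)
    (Finset.mem_univ v)).trans
    (Finset.single_le_sum (f := fun u ↦ ∑ v, f u v) (fun _ _ ↦ Nat.zero_le _)
      (Finset.mem_univ u))

lemma prodFrom_add {N : ℕ} (P : ℕ → Matrix (Fin N) (Fin N) ℝ) (t a b : ℕ) :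
    prodFrom P t (a + b) = prodFrom P (t + a) b * prodFrom P t a := by
  induction a generalizing t with
  | zero => simp [prodFrom]
  | succ a ih =>
    rw [show a + 1 + b = a + b + 1 by omega, prodFrom, prodFrom, ih, Matrix.mul_assoc,
      show t + 1 + a = t + (a + 1) by omega]

lemma prodFrom_nonneg {N : ℕ} {P : ℕ → Matrix (Fin N) (Fin N) ℝ} (hP : ∀ n i j, 0 ≤ P n i j)
    (t T : ℕ) (i j : Fin N) : 0 ≤ prodFrom P t T i j := by
  induction T generalizing t j with
  | zero => simp only [prodFrom, Matrix.one_apply]; split_ifs <;> norm_num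
  | succ T ih =>
    rw [prodFrom, Matrix.mul_apply]
    exact Finset.sum_nonneg fun l _ ↦ mul_nonneg (ih _ _) (hP _ _ _)

lemma pow_le_prodFrom {N : ℕ} {E : Fin N → Fin N → Prop} {P : ℕ → Matrix (Fin N) (Fin N) ℝ}
    (hP : ∀ n i j, 0 ≤ P n i j) {a : ℝ} (ha : 0 ≤ a) (hE : ∀ n i j, E j i → a ≤ P n i j)
    (t T : ℕ) {u v : Fin N} (h : relPow E T u v) : a ^ T ≤ prodFrom P t T v u := by
  induction T generalizing t u with
  | zero =>
    obtain rfl : u = v := h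
    simp [prodFrom]
  | succ T ih =>
    obtain ⟨c, hc, hcv⟩ := h
    rw [prodFrom, Matrix.mul_apply, pow_succ]
    refine (mul_le_mul (ih (t + 1) hcv) (hE t c u hc) ha (prodFrom_nonneg hP _ _ _ _)).trans ?_
    exact Finset.single_le_sum (f := fun l ↦ prodFrom P (t + 1) T v l * P t l u)
      (fun l _ ↦ mul_nonneg (prodFrom_nonneg hP _ _ _ _) (hP _ _ _)) (Finset.mem_univ c)

lemma prodFrom_le_pow {N : ℕ} {P : ℕ → Matrix (Fin N) (Fin N) ℝ}
    (hP : ∀ n i j, 0 ≤ P n i j) {b : ℝ} (hb : 0 ≤ b) (hsum : ∀ n i, ∑ j, P n i j ≤ b)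
    (t T : ℕ) (i j : Fin N) : prodFrom P t T i j ≤ b ^ T := by
  have key : ∑ j, prodFrom P t T i j ≤ b ^ T := by
    induction T generalizing t with
    | zero => simp [prodFrom, Matrix.one_apply]
    | succ T ih =>
      simp only [prodFrom, Matrix.mul_apply]
      rw [Finset.sum_comm, pow_succ]
      calc ∑ l, ∑ j, prodFrom P (t + 1) T i l * P t l j
          = ∑ l, prodFrom P (t + 1) T i l * ∑ j, P t l j := by simp only [Finset.mul_sum]
        _ ≤ ∑ l, prodFrom P (t + 1) T i l * b := Finset.sum_le_sum fun l _ ↦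
            mul_le_mul_of_nonneg_left (hsum t l) (prodFrom_nonneg hP _ _ _ _)
        _ = (∑ l, prodFrom P (t + 1) T i l) * b := by rw [Finset.sum_mul]
        _ ≤ b ^ T * b := mul_le_mul_of_nonneg_right (ih _) hb
  exact (Finset.single_le_sum (fun l _ ↦ prodFrom_nonneg hP t T i l) (Finset.mem_univ j)).trans key

section MulVec

variable {ι : Type*} [Fintype ι] {B : Matrix ι ι ℝ}

lemma mul_mulVec_le_mulVec (hB : ∀ i j, 0 ≤ B i j) {v w : ι → ℝ} {m : ℝ}
    (h : ∀ i, m * w i ≤ v i) (i : ι) : m * (B *ᵥ w) i ≤ (B *ᵥ v) i := by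
  simp only [Matrix.mulVec, dotProduct, Finset.mul_sum]
  refine Finset.sum_le_sum fun l _ ↦ ?_
  nlinarith [mul_le_mul_of_nonneg_left (h l) (hB i l)]

lemma mulVec_le_mul_mulVec (hB : ∀ i j, 0 ≤ B i j) {v w : ι → ℝ} {M : ℝ}
    (h : ∀ i, v i ≤ M * w i) (i : ι) : (B *ᵥ v) i ≤ M * (B *ᵥ w) i := by
  simp only [Matrix.mulVec, dotProduct, Finset.mul_sum]
  refine Finset.sum_le_sum fun l _ ↦ ?_
  nlinarith [mul_le_mul_of_nonneg_left (h l) (hB i l)]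

/-- The entries of the image of a nonnegative vector under a matrix with entries in `[α, β]`
are comparable. -/
lemma mulVec_comparable {α β : ℝ} (hα : 0 ≤ α) (hβ : 0 ≤ β) (hlo : ∀ i j, α ≤ B i j)
    (hhi : ∀ i j, B i j ≤ β) {w : ι → ℝ} (hw : ∀ i, 0 ≤ w i) (i j : ι) :
    α * (B *ᵥ w) i ≤ β * (B *ᵥ w) j := by
  have h1 : (B *ᵥ w) i ≤ β * ∑ l, w l := by
    simp only [Matrix.mulVec, dotProduct, Finset.mul_sum]
    exact Finset.sum_le_sum fun l _ ↦ mul_le_mul_of_nonneg_right (hhi i l) (hw l)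
  have h2 : α * ∑ l, w l ≤ (B *ᵥ w) j := by
    simp only [Matrix.mulVec, dotProduct, Finset.mul_sum]
    exact Finset.sum_le_sum fun l _ ↦ mul_le_mul_of_nonneg_right (hlo j l) (hw l)
  calc α * (B *ᵥ w) i ≤ α * (β * ∑ l, w l) := mul_le_mul_of_nonneg_left h1 hα
    _ = β * (α * ∑ l, w l) := by ring
    _ ≤ β * (B *ᵥ w) j := mul_le_mul_of_nonneg_left h2 hβ

/-- If `m w ≤ v` and one entry of `v` exceeds `m w` by a definite amount, then applying a matrix
with entries in `[α, β]` improves the lower bound in all entries. -/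
lemma improve_lower_bound {α β : ℝ} (hα : 0 < α) (hβ : 0 < β) (hlo : ∀ i j, α ≤ B i j)
    (hhi : ∀ i j, B i j ≤ β) {v w : ι → ℝ} (hw : ∀ i, 0 ≤ w i)
    (hcomp : ∀ i j, α * w i ≤ β * w j) {m d : ℝ} (hd : 0 ≤ d) (hm : ∀ i, m * w i ≤ v i)
    (k : ι) (hk : (m + d) * w k ≤ v k) (i : ι) :
    (m + α ^ 2 / (Fintype.card ι * β ^ 2) * d) * (B *ᵥ w) i ≤ (B *ᵥ v) i := by
  have hn : (0 : ℝ) < Fintype.card ι := by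
    exact_mod_cast Fintype.card_pos_iff.2 ⟨k⟩
  have h1 : α * (B *ᵥ w) i ≤ Fintype.card ι * (β ^ 2 * w k) := by
    have : α * (B *ᵥ w) i ≤ ∑ _l : ι, β ^ 2 * w k := by
      simp only [Matrix.mulVec, dotProduct, Finset.mul_sum]
      refine Finset.sum_le_sum fun l _ ↦ ?_
      nlinarith [mul_le_mul_of_nonneg_right (hhi i l) (hw l),
        mul_le_mul_of_nonneg_left (hcomp l k) hβ.le,
        mul_le_mul_of_nonneg_left (mul_le_mul_of_nonneg_right (hhi i l) (hw l)) hα.le]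
    simpa using this
  have h2 : m * (B *ᵥ w) i + α * (d * w k) ≤ (B *ᵥ v) i := by
    have h3 : B i k * (v k - m * w k) ≤ ∑ l, B i l * (v l - m * w l) :=
      Finset.single_le_sum (f := fun l ↦ B i l * (v l - m * w l))
        (fun l _ ↦ mul_nonneg (hα.le.trans (hlo i l)) (sub_nonneg.2 (hm l))) (Finset.mem_univ k)
    have h4 : ∑ l, B i l * (v l - m * w l) = (B *ᵥ v) i - m * (B *ᵥ w) i := by
      simp only [Matrix.mulVec, dotProduct, Finset.mul_sum, ← Finset.sum_sub_distrib]
      exact Finset.sum_congr rfl fun l _ ↦ by ring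
    have h5 : α * (d * w k) ≤ B i k * (v k - m * w k) :=
      mul_le_mul (hlo i k) (by linarith) (mul_nonneg hd (hw k)) (hα.le.trans (hlo i k))
    linarith
  have h6 : α ^ 2 / (Fintype.card ι * β ^ 2) * d * (B *ᵥ w) i ≤ α * (d * w k) := by
    rw [div_mul_eq_mul_div, div_mul_eq_mul_div, div_le_iff₀ (by positivity)]
    nlinarith [mul_le_mul_of_nonneg_left h1 (mul_nonneg hα.le hd)]
  linarith

/-- A matrix with entries in `[α, β]` contracts the range of the entrywise ratio of two vectors
by a fixed factor. -/
lemma contract_ratio [Nonempty ι] {α β : ℝ} (hα : 0 < α) (hβ : 0 < β) (hlo : ∀ i j, α ≤ B i j)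
    (hhi : ∀ i j, B i j ≤ β) {v w : ι → ℝ} (hw : ∀ i, 0 ≤ w i)
    (hcomp : ∀ i j, α * w i ≤ β * w j) {m M : ℝ} (hmM : m ≤ M) (hm : ∀ i, m * w i ≤ v i)
    (hM : ∀ i, v i ≤ M * w i) :
    ∃ m' M', M' - m' ≤ (1 - α ^ 2 / (Fintype.card ι * β ^ 2) / 2) * (M - m) ∧
      ∀ i, m' * (B *ᵥ w) i ≤ (B *ᵥ v) i ∧ (B *ᵥ v) i ≤ M' * (B *ᵥ w) i := by
  have hB : ∀ i j, 0 ≤ B i j := fun i j ↦ hα.le.trans (hlo i j)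
  have hd : 0 ≤ (M - m) / 2 := by linarith
  obtain ⟨k⟩ := ‹Nonempty ι›
  rcases le_total ((m + (M - m) / 2) * w k) (v k) with h | h
  · exact ⟨_, M, by linarith, fun i ↦
      ⟨improve_lower_bound hα hβ hlo hhi hw hcomp hd hm k h i, mulVec_le_mul_mulVec hB hM i⟩⟩
  · refine ⟨m, M - α ^ 2 / (Fintype.card ι * β ^ 2) * ((M - m) / 2), by linarith, fun i ↦
      ⟨mul_mulVec_le_mulVec hB hm i, ?_⟩⟩
    have := improve_lower_bound (v := -v) (m := -M) hα hβ hlo hhi hw hcomp hd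
      (fun i ↦ by simp only [Pi.neg_apply]; linarith [hM i]) k
      (by simp only [Pi.neg_apply]; linarith) i
    rw [Matrix.mulVec_neg, Pi.neg_apply] at this
    linarith

end MulVec

/-- A sequence of vectors whose range is nonincreasing and contracts by a fixed factor every
`L` steps converges to a constant vector. -/
lemma exists_tendsto_of_contracting {ι : Type*} [Fintype ι] [Nonempty ι] (r : ℕ → ι → ℝ) (L : ℕ)
    {η : ℝ} (hη : 0 < η)
    (hstep : ∀ t m M, (∀ i, m ≤ r t i ∧ r t i ≤ M) → ∀ i, m ≤ r (t + 1) i ∧ r (t + 1) i ≤ M)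
    (hcontr : ∀ t m M, (∀ i, m ≤ r t i ∧ r t i ≤ M) → ∃ m' M', M' - m' ≤ (1 - η) * (M - m) ∧
      ∀ i, m' ≤ r (t + L) i ∧ r (t + L) i ≤ M')
    (hpos : ∀ i, 0 < r 0 i) :
    ∃ c, 0 < c ∧ ∀ i, Tendsto (fun t ↦ r t i) atTop (𝓝 c) := by
  set lo : ℕ → ℝ := fun t ↦ Finset.univ.inf' Finset.univ_nonempty (r t)
  set hi : ℕ → ℝ := fun t ↦ Finset.univ.sup' Finset.univ_nonempty (r t)
  have hlo_le : ∀ t i, lo t ≤ r t i := fun t i ↦ Finset.inf'_le _ (Finset.mem_univ i)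
  have hle_hi : ∀ t i, r t i ≤ hi t := fun t i ↦ Finset.le_sup' _ (Finset.mem_univ i)
  have hbd : ∀ t i, lo t ≤ r t i ∧ r t i ≤ hi t := fun t i ↦ ⟨hlo_le t i, hle_hi t i⟩
  have le_lo : ∀ t m, (∀ i, m ≤ r t i) → m ≤ lo t := fun t m h ↦
    Finset.le_inf' _ _ fun i _ ↦ h i
  have hi_le : ∀ t M, (∀ i, r t i ≤ M) → hi t ≤ M := fun t m h ↦
    Finset.sup'_le _ _ fun i _ ↦ h i
  have hmono : Monotone lo := monotone_nat_of_le_succ fun t ↦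
    le_lo _ _ fun i ↦ (hstep t _ _ (hbd t) i).1
  have hanti : Antitone hi := antitone_nat_of_succ_le fun t ↦
    hi_le _ _ fun i ↦ (hstep t _ _ (hbd t) i).2
  have hlohi : ∀ t, lo t ≤ hi t := fun t ↦
    (hlo_le t (Classical.arbitrary ι)).trans (hle_hi t _)
  have ha := tendsto_atTop_ciSup hmono
    ⟨hi 0, by rintro _ ⟨t, rfl⟩; exact (hlohi t).trans (hanti (Nat.zero_le t))⟩
  have hb := tendsto_atTop_ciInf hanti
    ⟨lo 0, by rintro _ ⟨t, rfl⟩; exact (hmono (Nat.zero_le t)).trans (hlohi t)⟩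
  set a := ⨆ t, lo t
  set b := ⨅ t, hi t
  have hab : a ≤ b := le_of_tendsto_of_tendsto' ha hb hlohi
  have hosc : b - a ≤ (1 - η) * (b - a) := by
    refine le_of_tendsto_of_tendsto' ((hb.sub ha).comp (tendsto_add_atTop_nat L))
      ((hb.sub ha).const_mul (1 - η)) fun t ↦ ?_
    obtain ⟨m', M', h, hr⟩ := hcontr t _ _ (hbd t)
    have h1 := le_lo _ _ fun i ↦ (hr i).1
    have h2 := hi_le _ _ fun i ↦ (hr i).2
    simp only [Function.comp_apply]
    linarith
  have hba : b = a := by nlinarith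
  refine ⟨a, ?_, fun i ↦ tendsto_of_tendsto_of_tendsto_of_le_of_le ha (hba ▸ hb)
    (fun t ↦ hlo_le t i) (fun t ↦ hle_hi t i)⟩
  exact lt_of_lt_of_le ((Finset.lt_inf'_iff _).2 fun i _ ↦ hpos i)
    (hmono.ge_of_tendsto ha 0)

lemma rank_vecMulVec_eq_one {m n : Type*} [Fintype m] [Fintype n] {v : m → ℝ} {w : n → ℝ}
    (hv : v ≠ 0) (hw : w ≠ 0) : (vecMulVec v w).rank = 1 := by
  refine le_antisymm (Matrix.rank_vecMulVec_le v w) ?_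
  refine Module.finrank_pos_iff_exists_ne_zero.2 ⟨⟨_, LinearMap.mem_range_self _ w⟩, fun h ↦ ?_⟩
  have h' : vecMulVec v w *ᵥ w = 0 := congrArg Subtype.val h
  obtain ⟨i, hi⟩ := Function.ne_iff.1 hv
  have hmul : v i * (w ⬝ᵥ w) = 0 := by
    simpa [Matrix.mulVec, vecMulVec_apply, dotProduct, Finset.mul_sum, mul_assoc]
      using congrFun h' i
  exact (mul_ne_zero hi (dotProduct_self_eq_zero.not.2 hw)) hmul

/-- The columns of the partial products of nonnegative matrices, whose products of length `L`
have entries in `[α, β]`, become asymptotically proportional. -/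
lemma exists_tendsto_column_ratio {N : ℕ} [NeZero N] {P : ℕ → Matrix (Fin N) (Fin N) ℝ}
    (hP : ∀ n i j, 0 ≤ P n i j) {α β : ℝ} (hα : 0 < α) (hβ : 0 < β) {L : ℕ}
    (hlo : ∀ t i j, α ≤ prodFrom P t L i j) (hhi : ∀ t i j, prodFrom P t L i j ≤ β)
    (hpos : ∀ t, L ≤ t → ∀ i j, 0 < prodFrom P 0 t i j) (j k : Fin N) :
    ∃ c, 0 < c ∧ ∀ i, Tendsto (fun t ↦ prodFrom P 0 t i j / prodFrom P 0 t i k) atTop (𝓝 c) := by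
  have hcol : ∀ a b l, (fun i ↦ prodFrom P 0 (a + b) i l) =
      prodFrom P a b *ᵥ fun i ↦ prodFrom P 0 a i l := by
    intro a b l
    ext i
    rw [prodFrom_add, Nat.zero_add, Matrix.mul_apply]
    rfl
  have hone : ∀ t i l, 0 ≤ prodFrom P t 1 i l := fun t ↦ prodFrom_nonneg hP t 1
  have hratio : ∀ s m M, L ≤ s →
      ((∀ i, m ≤ prodFrom P 0 s i j / prodFrom P 0 s i k ∧
        prodFrom P 0 s i j / prodFrom P 0 s i k ≤ M) ↔
      ∀ i, m * prodFrom P 0 s i k ≤ prodFrom P 0 s i j ∧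
        prodFrom P 0 s i j ≤ M * prodFrom P 0 s i k) := fun s m M hs ↦
    forall_congr' fun i ↦ by rw [le_div_iff₀ (hpos s hs i k), div_le_iff₀ (hpos s hs i k)]
  have hη : 0 < α ^ 2 / (Fintype.card (Fin N) * β ^ 2) / 2 := by
    have : (0 : ℝ) < Fintype.card (Fin N) := by exact_mod_cast Fintype.card_pos
    positivity
  suffices h : ∃ c, 0 < c ∧ ∀ i, Tendsto
      (fun t ↦ prodFrom P 0 (L + t) i j / prodFrom P 0 (L + t) i k) atTop (𝓝 c) by
    obtain ⟨c, hc, hlim⟩ := h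
    exact ⟨c, hc, fun i ↦ (tendsto_add_atTop_iff_nat L).1 (by simpa only [add_comm] using hlim i)⟩
  refine exists_tendsto_of_contracting
    (fun t i ↦ prodFrom P 0 (L + t) i j / prodFrom P 0 (L + t) i k) L hη ?_ ?_ ?_
  · intro t m M h
    rw [hratio _ _ _ (by omega)] at h
    refine (hratio _ _ _ (by omega)).2 fun i ↦ ?_
    have hj := congrFun (hcol (L + t) 1 j) i
    have hk := congrFun (hcol (L + t) 1 k) i
    rw [← add_assoc, hj, hk]
    exact ⟨mul_mulVec_le_mulVec (hone _) (fun i ↦ (h i).1) i,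
      mulVec_le_mul_mulVec (hone _) (fun i ↦ (h i).2) i⟩
  · intro t m M h
    have hmM : m ≤ M := (h 0).1.trans (h 0).2
    rw [hratio _ _ _ (by omega)] at h
    have hcomp : ∀ i i', α * prodFrom P 0 (L + t) i k ≤ β * prodFrom P 0 (L + t) i' k := by
      intro i i'
      have e := hcol t L k
      rw [add_comm L t, congrFun e i, congrFun e i']
      exact mulVec_comparable hα.le hβ.le (hlo t) (hhi t)
        (fun l ↦ prodFrom_nonneg hP 0 t l k) i i'
    obtain ⟨m', M', hle, hb⟩ := contract_ratio hα hβ (hlo (L + t)) (hhi (L + t))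
      (fun i ↦ prodFrom_nonneg hP 0 (L + t) i k) hcomp hmM
      (fun i ↦ (h i).1) (fun i ↦ (h i).2)
    refine ⟨m', M', hle, (hratio _ _ _ (by omega)).2 fun i ↦ ?_⟩
    have hj := congrFun (hcol (L + t) L j) i
    have hk := congrFun (hcol (L + t) L k) i
    rw [← add_assoc, hj, hk]
    exact hb i
  · exact fun i ↦ div_pos (hpos _ (by omega) i j) (hpos _ (by omega) i k)

/-- For a strongly connected graph with self-loops, and factors
`P^{(n)} = D^{(n)} A^{(n)}` with `A^{(n)}` row-stochastic and `ε`-supported on the graph and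
`D^{(n)}` diagonal with entries in `[C₁, C₂]`, the sequence of partial products
`P^{(t)} ⋯ P^{(0)}` is ergodic: there are entrywise positive rank-one matrices `S^{(t)}` with
`(P^{(t)} ⋯ P^{(0)})_{ij} / S^{(t)}_{ij} → 1`. -/
theorem partial_products_ergodic
    (N : ℕ) (hN : 0 < N)
    (E : Fin N → Fin N → Prop)
    (hloop : ∀ i, E i i)
    (hconn : ∀ u v, ∃ m, relPow E m u v)
    (ε C₁ C₂ : ℝ) (hε : 0 < ε) (hC₁ : 0 < C₁) (hC₂ : 0 < C₂)
    (A : ℕ → Matrix (Fin N) (Fin N) ℝ)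
    (hA_nonneg : ∀ n i j, 0 ≤ A n i j)
    (hA_rowsum : ∀ n i, ∑ j, A n i j = 1)
    (hA_supp : ∀ n i j, (E j i → ε ≤ A n i j) ∧ (¬ E j i → A n i j = 0))
    (D : ℕ → Fin N → ℝ)
    (hD : ∀ n i, C₁ ≤ D n i ∧ D n i ≤ C₂)
    (P : ℕ → Matrix (Fin N) (Fin N) ℝ)
    (hP : ∀ n, P n = Matrix.diagonal (D n) * A n) :
    ∃ S : ℕ → Matrix (Fin N) (Fin N) ℝ,
      (∀ t, (∀ i j, 0 < S t i j) ∧ (S t).rank = 1) ∧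
      ∀ i j : Fin N,
        Filter.Tendsto (fun t => prodFrom P 0 (t + 1) i j / S t i j)
          Filter.atTop (nhds 1) := by
  have : NeZero N := ⟨hN.ne'⟩
  have hP_apply : ∀ n i j, P n i j = D n i * A n i j := fun n i j ↦ by
    rw [hP, Matrix.diagonal_mul]
  have hP_nonneg : ∀ n i j, 0 ≤ P n i j := fun n i j ↦ by
    rw [hP_apply]
    exact mul_nonneg (hC₁.le.trans (hD n i).1) (hA_nonneg n i j)
  have hP_edge : ∀ n i j, E j i → C₁ * ε ≤ P n i j := fun n i j h ↦ by
    rw [hP_apply]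
    exact mul_le_mul (hD n i).1 ((hA_supp n i j).1 h) hε.le (hC₁.le.trans (hD n i).1)
  have hP_sum : ∀ n i, ∑ j, P n i j ≤ C₂ := fun n i ↦ by
    simp only [hP_apply, ← Finset.mul_sum, hA_rowsum, mul_one]
    exact (hD n i).2
  have hCε : 0 < C₁ * ε := mul_pos hC₁ hε
  obtain ⟨L, hL⟩ := exists_forall_relPow hloop hconn
  have hpos : ∀ t, L ≤ t → ∀ i j, 0 < prodFrom P 0 t i j := fun t ht i j ↦
    (pow_pos hCε t).trans_le (pow_le_prodFrom hP_nonneg hCε.le hP_edge 0 t (hL t ht j i))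
  choose c hc hlim using fun j ↦ exists_tendsto_column_ratio hP_nonneg (pow_pos hCε L)
    (pow_pos hC₂ L) (fun t i j ↦ pow_le_prodFrom hP_nonneg hCε.le hP_edge t L (hL L le_rfl j i))
    (prodFrom_le_pow hP_nonneg hC₂.le hP_sum · L) hpos j 0
  let v : ℕ → Fin N → ℝ := fun t i ↦ if L ≤ t then prodFrom P 0 (t + 1) i 0 else 1
  have hv : ∀ t i, 0 < v t i := fun t i ↦ by
    simp only [v]
    split_ifs with h
    · exact hpos _ (by omega) i 0
    · exact one_pos
  refine ⟨fun t ↦ vecMulVec (v t) c, fun t ↦ ⟨fun i j ↦ mul_pos (hv t i) (hc j),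
    rank_vecMulVec_eq_one (fun h ↦ (hv t 0).ne' (congrFun h 0))
      (fun h ↦ (hc 0).ne' (congrFun h 0))⟩, fun i j ↦ ?_⟩
  have h := ((tendsto_add_atTop_iff_nat 1).2 (hlim j i)).div_const (c j)
  rw [div_self (hc j).ne'] at h
  refine h.congr' ?_
  filter_upwards [eventually_ge_atTop L] with t ht
  simp only [vecMulVec_apply, v, if_pos ht, div_div]
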